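/- Assume b > 0, and for every z ∈ ℝ let Prox(z; b) denote the unique minimizer over ℝ of x ↦ b·ρ_C(x) + (x − z)²/2. Define the effective score G̃(z; b) = z − Prox(z; b). Then for every z ∈ ℝ the number G̃(z; b)/b is a subgradient of ρ_C at Prox(z; b), and explicitly G̃(z; b) = b·h(ℓ) whenever u_ℓ + b·h(ℓ) < z < u_{ℓ+1} + b·h(ℓ) for some ℓ ∈ {0, …, K}, while G̃(z; b) = z − u_ℓ whenever u_ℓ + b·h(ℓ−1) ≤ z ≤ u_ℓ + b·h(ℓ) for some ℓ ∈ {1, …, K}. -/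

import Mathlib

/-- Single quantile loss `ρ_{τ,u}(x) = (x − u)(τ − 1{x ≤ u})`. -/
noncomputable def quantLoss (τ u x : ℝ) : ℝ := (x - u) * (τ - if x ≤ u then 1 else 0)

/-- Composite quantile loss `ρ_C(x) = Σ_{k=1}^K w_k ρ_{τ_k,u_k}(x)`. -/
noncomputable def compLoss (K : ℕ) (τ u w : ℕ → ℝ) (x : ℝ) : ℝ :=
  ∑ k ∈ Finset.Icc 1 K, w k * quantLoss (τ k) (u k) x

/-- `h(ℓ) = Σ_{k=1}^ℓ w_k τ_k − Σ_{k=ℓ+1}^K w_k (1 − τ_k)`. -/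
noncomputable def hFun (K : ℕ) (τ w : ℕ → ℝ) (ℓ : ℕ) : ℝ :=
  ∑ k ∈ Finset.Icc 1 ℓ, w k * τ k - ∑ k ∈ Finset.Icc (ℓ + 1) K, w k * (1 - τ k)

theorem aux_quant_conv (τ u x y t : ℝ) (h0 : 0 < τ) (h1 : τ < 1) (ht0 : 0 ≤ t) (ht1 : t ≤ 1) :
    quantLoss τ u (x + t * (y - x)) ≤ (1 - t) * quantLoss τ u x + t * quantLoss τ u y := by
  have e : ∀ v, τ * (v - u) ≤ quantLoss τ u v ∧ (τ - 1) * (v - u) ≤ quantLoss τ u v := by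
    intro v
    unfold quantLoss
    split_ifs with h <;> constructor <;> nlinarith
  obtain ⟨a1, a2⟩ := e x
  obtain ⟨b1, b2⟩ := e y
  have ht : 0 ≤ 1 - t := by linarith
  have c1 := mul_le_mul_of_nonneg_left a1 ht
  have c2 := mul_le_mul_of_nonneg_left a2 ht
  have d1 := mul_le_mul_of_nonneg_left b1 ht0
  have d2 := mul_le_mul_of_nonneg_left b2 ht0
  have f : quantLoss τ u (x + t * (y - x)) = τ * (x + t * (y - x) - u) ∨
      quantLoss τ u (x + t * (y - x)) = (τ - 1) * (x + t * (y - x) - u) := by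
    unfold quantLoss
    split_ifs
    · right; ring
    · left; ring
  rcases f with f | f <;> rw [f] <;> linarith

theorem aux_quant_right (τ u x y : ℝ) (hx : u ≤ x) :
    quantLoss τ u x + τ * (y - x) ≤ quantLoss τ u y := by
  unfold quantLoss
  split_ifs <;> nlinarith

theorem aux_quant_left (τ u x y : ℝ) (hx : x ≤ u) :
    quantLoss τ u x + (τ - 1) * (y - x) ≤ quantLoss τ u y := by
  unfold quantLoss
  split_ifs <;> nlinarith

theorem aux_hFun (K : ℕ) (τ w : ℕ → ℝ) (l : ℕ) (hl : l ≤ K) :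
    hFun K τ w l = ∑ k ∈ Finset.Icc 1 K, w k * (τ k - if k ≤ l then 0 else 1) := by
  have hd : Finset.Icc 1 K = Finset.Icc 1 l ∪ Finset.Icc (l + 1) K := by
    ext k; simp only [Finset.mem_union, Finset.mem_Icc]; omega
  have hdis : Disjoint (Finset.Icc 1 l) (Finset.Icc (l + 1) K) := by
    rw [Finset.disjoint_left]; intro k; simp only [Finset.mem_Icc]; omega
  rw [hd, Finset.sum_union hdis, hFun, sub_eq_add_neg, ← Finset.sum_neg_distrib]
  congr 1
  · refine Finset.sum_congr rfl fun k hk => ?_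
    rw [Finset.mem_Icc] at hk
    rw [if_pos hk.2]; ring
  · refine Finset.sum_congr rfl fun k hk => ?_
    rw [Finset.mem_Icc] at hk
    rw [if_neg (by omega)]; ring

theorem aux_mono (K : ℕ) (u : ℕ → ℝ) (humono : ∀ k, 1 ≤ k → k < K → u k < u (k + 1))
    (i j : ℕ) (hi : 1 ≤ i) (hij : i ≤ j) (hj : j ≤ K) : u i ≤ u j := by
  induction j, hij using Nat.le_induction with
  | base => exact le_rfl
  | succ n hn ih => exact (ih (by omega)).trans (humono n (by omega) (by omega)).le

theorem aux_subgrad (K : ℕ) (τ u w : ℕ → ℝ)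
    (humono : ∀ k, 1 ≤ k → k < K → u k < u (k + 1))
    (hw : ∀ k ∈ Finset.Icc 1 K, 0 ≤ w k) (l : ℕ) (hl : l ≤ K) (x : ℝ)
    (h1 : 1 ≤ l → u l ≤ x) (h2 : l < K → x ≤ u (l + 1)) (y : ℝ) :
    compLoss K τ u w x + hFun K τ w l * (y - x) ≤ compLoss K τ u w y := by
  rw [aux_hFun K τ w l hl, compLoss, compLoss, Finset.sum_mul, ← Finset.sum_add_distrib]
  refine Finset.sum_le_sum fun k hk => ?_
  have hwk := hw k hk
  rw [Finset.mem_Icc] at hk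
  rw [mul_assoc, ← mul_add]
  refine mul_le_mul_of_nonneg_left ?_ hwk
  split_ifs with h
  · rw [sub_zero]
    exact aux_quant_right _ _ _ _
      ((aux_mono K u humono k l hk.1 h hl).trans (h1 (by omega)))
  · exact aux_quant_left _ _ _ _
      ((h2 (by omega)).trans (aux_mono K u humono (l + 1) k (by omega) (by omega) hk.2))

theorem effective_score_composite_quantile
    (K : ℕ) (hK : 1 ≤ K) (τ u w : ℕ → ℝ)
    (hτ0 : ∀ k ∈ Finset.Icc 1 K, 0 < τ k) (hτ1 : ∀ k ∈ Finset.Icc 1 K, τ k < 1)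
    (hτmono : ∀ k, 1 ≤ k → k < K → τ k < τ (k + 1))
    (humono : ∀ k, 1 ≤ k → k < K → u k < u (k + 1))
    (hw : ∀ k ∈ Finset.Icc 1 K, 0 ≤ w k)
    (hwsum : ∑ k ∈ Finset.Icc 1 K, w k = 1)
    (b : ℝ) (hb : 0 < b)
    (Prox : ℝ → ℝ)
    (hProxMin : ∀ z y : ℝ, b * compLoss K τ u w (Prox z) + (Prox z - z) ^ 2 / 2
        ≤ b * compLoss K τ u w y + (y - z) ^ 2 / 2)
    (hProxUnique : ∀ z x : ℝ, (∀ y : ℝ, b * compLoss K τ u w x + (x - z) ^ 2 / 2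
        ≤ b * compLoss K τ u w y + (y - z) ^ 2 / 2) → x = Prox z)
    (G : ℝ → ℝ) (hG : ∀ z, G z = z - Prox z) :
    (∀ z y : ℝ, compLoss K τ u w y
        ≥ compLoss K τ u w (Prox z) + G z / b * (y - Prox z)) ∧
    (∀ ℓ ≤ K, ∀ z : ℝ, (1 ≤ ℓ → u ℓ + b * hFun K τ w ℓ < z) →
        (ℓ < K → z < u (ℓ + 1) + b * hFun K τ w ℓ) → G z = b * hFun K τ w ℓ) ∧
    (∀ ℓ, 1 ≤ ℓ → ℓ ≤ K → ∀ z : ℝ, u ℓ + b * hFun K τ w (ℓ - 1) ≤ z →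
        z ≤ u ℓ + b * hFun K τ w ℓ → G z = z - u ℓ) := by
  have key : ∀ z x g : ℝ, z - x = b * g →
      (∀ y, compLoss K τ u w x + g * (y - x) ≤ compLoss K τ u w y) → x = Prox z := by
    intro z x g hg hs
    refine hProxUnique z x fun y => ?_
    have h1 := mul_le_mul_of_nonneg_left (hs y) hb.le
    have hz : z = x + b * g := by linarith
    subst hz
    nlinarith [sq_nonneg (y - x)]
  refine ⟨?_, ?_, ?_⟩
  · intro z y
    have hconv : ∀ t : ℝ, 0 ≤ t → t ≤ 1 → compLoss K τ u w (Prox z + t * (y - Prox z)) ≤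
        (1 - t) * compLoss K τ u w (Prox z) + t * compLoss K τ u w y := by
      intro t ht0 ht1
      simp only [compLoss]
      rw [Finset.mul_sum, Finset.mul_sum, ← Finset.sum_add_distrib]
      refine Finset.sum_le_sum fun k hk => ?_
      have := mul_le_mul_of_nonneg_left
        (aux_quant_conv (τ k) (u k) (Prox z) y t (hτ0 k hk) (hτ1 k hk) ht0 ht1) (hw k hk)
      linarith
    rw [hG]
    have hMin := hProxMin z
    clear hProxMin hProxUnique key
    generalize Prox z = p at *
    have main : ∀ t : ℝ, 0 < t → t ≤ 1 →
        0 ≤ b * (compLoss K τ u w y - compLoss K τ u w p) + (p - z) * (y - p)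
          + t * ((y - p) ^ 2 / 2) := by
      intro t ht0 ht1
      have h1 := hMin (p + t * (y - p))
      have h2 := mul_le_mul_of_nonneg_left (hconv t ht0.le ht1) hb.le
      refine nonneg_of_mul_nonneg_right (a := t) ?_ ht0
      nlinarith
    have lim : 0 ≤ b * (compLoss K τ u w y - compLoss K τ u w p) + (p - z) * (y - p) := by
      by_contra hneg
      push Not at hneg
      set A := b * (compLoss K τ u w y - compLoss K τ u w p) + (p - z) * (y - p)
      set C := (y - p) ^ 2 / 2 with hC
      have hC0 : 0 ≤ C := by positivity
      have hd : 0 < C - A := by linarith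
      have hd2 : 0 < C - A + 1 := by linarith
      have := main (-A / (C - A)) (div_pos (by linarith) hd)
        ((div_le_one hd).2 (by linarith))
      have e : A + -A / (C - A) * C = -(A * A) / (C - A) := by
        field_simp; ring
      rw [e] at this
      have : -(A * A) / (C - A) < 0 := div_neg_of_neg_of_pos (by nlinarith) hd
      linarith
    have : (z - p) / b * (y - p) ≤ compLoss K τ u w y - compLoss K τ u w p := by
      rw [div_mul_eq_mul_div, div_le_iff₀ hb]
      linarith
    linarith
  · intro l hl z h1 h2
    have := key z (z - b * hFun K τ w l) (hFun K τ w l) (by ring)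
      (aux_subgrad K τ u w humono hw l hl _ (fun h => by linarith [h1 h])
        (fun h => by linarith [h2 h]))
    rw [hG, ← this]; ring
  · intro l hl1 hl z h1 h2
    have := key z (u l) ((z - u l) / b) (by field_simp) (by
      intro y
      have s1 := aux_subgrad K τ u w humono hw l hl (u l) (fun _ => le_rfl)
        (fun h => (humono l hl1 h).le) y
      have s2 := aux_subgrad K τ u w humono hw (l - 1) (by omega) (u l)
        (fun h => aux_mono K u humono _ _ h (by omega) hl)
        (fun _ => by rw [Nat.sub_add_cancel hl1]) y
      have g1 : hFun K τ w (l - 1) ≤ (z - u l) / b := by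
        rw [le_div_iff₀ hb]; linarith
      have g2 : (z - u l) / b ≤ hFun K τ w l := by
        rw [div_le_iff₀ hb]; linarith
      rcases le_total (u l) y with h | h
      · have := mul_le_mul_of_nonneg_right g2 (sub_nonneg.2 h)
        linarith
      · have := mul_le_mul_of_nonpos_right g1 (sub_nonpos.2 h)
        linarith)
    rw [hG, ← this]
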